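/- Let {△̄, A} be an exact interpolation problem on a strip of n triangles, and suppose two successive triangles Δₖ and Δₖ₊₁ with 2 ≤ k ≤ n−2 contain no nodes of A. Then {△̄, A} is poised if and only if both reduced problems — the problem on △̄₁^{k−1} with node set A₁^{k−1}, and the problem on △̄_{k+2}^n with node set A_{k+2}^n — are exact and poised. -/

import Mathlib

open scoped Classical

noncomputable section

/-- Points of the plane. -/
abbrev E : Type := ℝ × ℝ

/-- The closed triangle `Δᵢ` with vertices `V i`, `V (i+1)`, `V (i+2)`. -/
def tri (V : ℕ → E) (i : ℕ) : Set E :=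
  convexHull ℝ {V i, V (i + 1), V (i + 2)}

/-- `V 1, …, V (n+2)` are the vertices of a strip of `n` triangles
`Δ₁, …, Δₙ`, where `Δᵢ = [Vᵢ, Vᵢ₊₁, Vᵢ₊₂]`. -/
structure IsStrip (n : ℕ) (V : ℕ → E) : Prop where
  indep : ∀ i, 1 ≤ i → i ≤ n → AffineIndependent ℝ ![V i, V (i + 1), V (i + 2)]
  adj : ∀ i, 1 ≤ i → i + 1 ≤ n →
    tri V i ∩ tri V (i + 1) = segment ℝ (V (i + 1)) (V (i + 2))
  touch : ∀ i, 1 ≤ i → i + 2 ≤ n → tri V i ∩ tri V (i + 2) = {V (i + 2)}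
  disj : ∀ i j, 1 ≤ i → j ≤ n → i + 3 ≤ j → tri V i ∩ tri V j = ∅

/-- The underlying set `|△̄ₖᵐ|` of the (sub)strip consisting of the triangles
`Δ k, …, Δ m`. -/
def stripSet (V : ℕ → E) (k m : ℕ) : Set E :=
  ⋃ i ∈ Finset.Icc k m, tri V i

/-- The space `S(△̄ₖᵐ)` of continuous functions on the strip `|△̄ₖᵐ|` whose
restriction to each triangle `Δᵢ`, `k ≤ i ≤ m`, agrees with an affine
function `ℝ² → ℝ`. -/
def stripSpace (V : ℕ → E) (k m : ℕ) : Submodule ℝ (stripSet V k m → ℝ) where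
  carrier := {s | Continuous s ∧ ∀ i ∈ Finset.Icc k m, ∃ f : E →ᵃ[ℝ] ℝ,
    ∀ x : stripSet V k m, (x : E) ∈ tri V i → s x = f x}
  add_mem' := by
    rintro a b ⟨hca, ha⟩ ⟨hcb, hb⟩
    refine ⟨hca.add hcb, fun i hi => ?_⟩
    obtain ⟨f, hf⟩ := ha i hi
    obtain ⟨g, hg⟩ := hb i hi
    exact ⟨f + g, fun x hx => by simp [hf x hx, hg x hx]⟩
  zero_mem' := ⟨continuous_const, fun i hi => ⟨0, fun x hx => by simp⟩⟩
  smul_mem' := by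
    rintro c a ⟨hca, ha⟩
    refine ⟨hca.const_smul c, fun i hi => ?_⟩
    obtain ⟨f, hf⟩ := ha i hi
    exact ⟨c • f, fun x hx => by simp [hf x hx]⟩

/-- Poisedness of a node set `A` for a subspace `T` of the functions on the
strip `|△̄ₖᵐ|`: for every data `c` there is a unique `s ∈ T` interpolating
`c` at the nodes. -/
def PoisedFor (V : ℕ → E) (k m : ℕ) (T : Submodule ℝ (stripSet V k m → ℝ))
    (A : Finset E) : Prop :=
  ∀ c : E → ℝ, ∃! s : stripSet V k m → ℝ,
    s ∈ T ∧ ∀ a : stripSet V k m, (a : E) ∈ A → s a = c a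

/-- Poisedness of the interpolation problem `{△̄ₖᵐ, A}`. -/
def Poised (V : ℕ → E) (k m : ℕ) (A : Finset E) : Prop :=
  PoisedFor V k m (stripSpace V k m) A

/-- The node set `Aₖᵐ = A ∩ |△̄ₖᵐ|` of the subproblem `{△̄, A}ₖᵐ`. -/
def nodesIn (V : ℕ → E) (k m : ℕ) (A : Finset E) : Finset E :=
  A.filter (fun x => x ∈ stripSet V k m)

/-- The nodes of `A` lying in the triangle `Δᵢ`. -/
def triNodes (V : ℕ → E) (i : ℕ) (A : Finset E) : Finset E :=
  A.filter (fun x => x ∈ tri V i)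

/-- Affine functions agreeing on a set agree on its convex hull. -/
lemma affineMap_eqOn_convexHull {f g : E →ᵃ[ℝ] ℝ} {S : Set E} (h : Set.EqOn f g S) :
    Set.EqOn f g (convexHull ℝ S) := by
  intro x hx
  have hc : Convex ℝ ((f - g) ⁻¹' {(0 : ℝ)}) := (convex_singleton 0).affine_preimage (f - g)
  have hS : S ⊆ (f - g) ⁻¹' {(0 : ℝ)} := fun y hy => by simp [h hy]
  have := convexHull_min hS hc hx
  simpa [sub_eq_zero] using this

/-- An affine function on the plane can be prescribed at three affinely independent points. -/
lemma exists_affineMap_of_affineIndependent {a b c : E} (h : AffineIndependent ℝ ![a, b, c])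
    (u v w : ℝ) : ∃ f : E →ᵃ[ℝ] ℝ, f a = u ∧ f b = v ∧ f c = w := by
  have htop : affineSpan ℝ (Set.range ![a, b, c]) = ⊤ := by
    rw [h.affineSpan_eq_top_iff_card_eq_finrank_add_one]
    simp
  let B : AffineBasis (Fin 3) ℝ E := ⟨![a, b, c], h, htop⟩
  have h0 : a = B 0 := rfl
  have h1 : b = B 1 := rfl
  have h2 : c = B 2 := rfl
  refine ⟨u • B.coord 0 + v • B.coord 1 + w • B.coord 2, ?_, ?_, ?_⟩
  · rw [h0]; simp
  · rw [h1]; simp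
  · rw [h2]; simp

lemma tri_subset_stripSet {V : ℕ → E} {k m i : ℕ} (hki : k ≤ i) (him : i ≤ m) :
    tri V i ⊆ stripSet V k m :=
  Set.subset_biUnion_of_mem (u := fun i => tri V i)
    (show i ∈ Finset.Icc k m from Finset.mem_Icc.2 ⟨hki, him⟩)

lemma mem_stripSet {V : ℕ → E} {k m : ℕ} {x : E} :
    x ∈ stripSet V k m ↔ ∃ i, k ≤ i ∧ i ≤ m ∧ x ∈ tri V i := by
  simp [stripSet, and_assoc]

lemma stripSet_mono {V : ℕ → E} {k m k' m' : ℕ} (hk : k' ≤ k) (hm : m ≤ m') :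
    stripSet V k m ⊆ stripSet V k' m' := by
  intro x hx
  obtain ⟨i, h1, h2, h3⟩ := mem_stripSet.1 hx
  exact mem_stripSet.2 ⟨i, hk.trans h1, h2.trans hm, h3⟩

lemma vertex_mem_tri {V : ℕ → E} {i j : ℕ} (hij : i ≤ j) (hji : j ≤ i + 2) : V j ∈ tri V i := by
  apply subset_convexHull
  obtain rfl | rfl | rfl : j = i ∨ j = i + 1 ∨ j = i + 2 := by omega
  all_goals simp

lemma vertex_mem_stripSet {V : ℕ → E} {k m j : ℕ} (hkm : k ≤ m) (hkj : k ≤ j)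
    (hjm : j ≤ m + 2) : V j ∈ stripSet V k m := by
  by_cases h : j ≤ m
  · exact tri_subset_stripSet hkj h (vertex_mem_tri le_rfl (by omega))
  · exact tri_subset_stripSet hkm le_rfl (vertex_mem_tri (by omega) hjm)

lemma nodesIn_subset (V : ℕ → E) (k m : ℕ) (A : Finset E) :
    ↑(nodesIn V k m A) ⊆ stripSet V k m :=
  fun _ ha => (Finset.mem_filter.1 ha).2

lemma isClosed_tri (V : ℕ → E) (i : ℕ) : IsClosed (tri V i) :=
  (Set.Finite.isCompact_convexHull (𝕜 := ℝ) (Set.toFinite _)).isClosed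

/-- Splines agreeing at all vertices are equal. -/
lemma stripSpace_ext {V : ℕ → E} {k m : ℕ} {s t : stripSet V k m → ℝ}
    (hs : s ∈ stripSpace V k m) (ht : t ∈ stripSpace V k m)
    (h : ∀ x : stripSet V k m, ∀ j, k ≤ j → j ≤ m + 2 → (x : E) = V j → s x = t x) :
    s = t := by
  funext x
  obtain ⟨i, hki, him, hx⟩ := mem_stripSet.1 x.2
  obtain ⟨f, hf⟩ := hs.2 i (Finset.mem_Icc.2 ⟨hki, him⟩)
  obtain ⟨g, hg⟩ := ht.2 i (Finset.mem_Icc.2 ⟨hki, him⟩)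
  have hv : ∀ j, i ≤ j → j ≤ i + 2 → f (V j) = g (V j) := by
    intro j hij hji
    have hj := vertex_mem_tri (V := V) hij hji
    have := h ⟨V j, tri_subset_stripSet hki him hj⟩ j (by omega) (by omega) rfl
    rwa [hf _ hj, hg _ hj] at this
  rw [hf x hx, hg x hx]
  refine affineMap_eqOn_convexHull ?_ hx
  rintro y (rfl | rfl | rfl)
  · exact hv _ le_rfl (by omega)
  · exact hv _ (by omega) (by omega)
  · exact hv _ (by omega) le_rfl

/-- The values of a spline at the vertices of a strip can be prescribed. -/
lemma exists_mem_stripSpace_of_vertex_values {n : ℕ} {V : ℕ → E} (hV : IsStrip n V) {k m : ℕ}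
    (hk : 1 ≤ k) (hm : m ≤ n) (v : ℕ → ℝ) :
    ∃ s ∈ stripSpace V k m, ∀ x : stripSet V k m, ∀ j, k ≤ j → j ≤ m + 2 → (x : E) = V j →
      s x = v j := by
  have hex : ∀ i, ∃ f : E →ᵃ[ℝ] ℝ, 1 ≤ i → i ≤ n →
      f (V i) = v i ∧ f (V (i + 1)) = v (i + 1) ∧ f (V (i + 2)) = v (i + 2) := by
    intro i
    by_cases hi : 1 ≤ i ∧ i ≤ n
    · obtain ⟨f, hf⟩ := exists_affineMap_of_affineIndependent (hV.indep i hi.1 hi.2)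
        (v i) (v (i + 1)) (v (i + 2))
      exact ⟨f, fun _ _ => hf⟩
    · exact ⟨0, fun h1 h2 => absurd ⟨h1, h2⟩ hi⟩
  choose f hf using hex
  have hlt : ∀ i j x, 1 ≤ i → j ≤ n → i < j → x ∈ tri V i → x ∈ tri V j → f i x = f j x := by
    intro i j x hi hj hij hxi hxj
    obtain ⟨a1, a2, a3⟩ := hf i hi (by omega)
    obtain ⟨b1, b2, b3⟩ := hf j (by omega) hj
    obtain rfl | rfl | h : j = i + 1 ∨ j = i + 2 ∨ i + 3 ≤ j := by omega
    · have hx : x ∈ segment ℝ (V (i + 1)) (V (i + 2)) := hV.adj i hi hj ▸ ⟨hxi, hxj⟩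
      rw [← convexHull_pair] at hx
      refine affineMap_eqOn_convexHull ?_ hx
      rintro y (rfl | rfl)
      · rw [a2, b1]
      · rw [a3, b2]
    · have hx : x ∈ ({V (i + 2)} : Set E) := hV.touch i hi hj ▸ ⟨hxi, hxj⟩
      obtain rfl : x = V (i + 2) := hx
      rw [a3, b1]
    · have hx : x ∈ (∅ : Set E) := hV.disj i j hi hj h ▸ ⟨hxi, hxj⟩
      exact hx.elim
  have hagree : ∀ i j x, 1 ≤ i → i ≤ n → 1 ≤ j → j ≤ n → x ∈ tri V i → x ∈ tri V j →
      f i x = f j x := by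
    intro i j x hi hi' hj hj' hxi hxj
    rcases lt_trichotomy i j with h | rfl | h
    · exact hlt i j x hi hj' h hxi hxj
    · rfl
    · exact (hlt j i x hj hi' h hxj hxi).symm
  choose idx hidx using fun x : stripSet V k m => mem_stripSet.1 x.2
  have hs : ∀ i, k ≤ i → i ≤ m → ∀ x : stripSet V k m, (x : E) ∈ tri V i →
      f (idx x) x = f i x := by
    intro i hki him x hx
    obtain ⟨h1, h2, h3⟩ := hidx x
    exact hagree _ _ _ (by omega) (by omega) (by omega) (by omega) h3 hx
  refine ⟨fun x => f (idx x) x, ⟨?_, ?_⟩, ?_⟩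
  · refine (locallyFinite_of_finite
      (fun i : Finset.Icc k m => {x : stripSet V k m | (x : E) ∈ tri V i})).continuous ?_ ?_ ?_
    · refine Set.eq_univ_of_forall fun x => Set.mem_iUnion.2 ⟨⟨idx x, ?_⟩, (hidx x).2.2⟩
      exact Finset.mem_Icc.2 ⟨(hidx x).1, (hidx x).2.1⟩
    · exact fun i => (isClosed_tri V i).preimage continuous_subtype_val
    · intro i
      have hi := Finset.mem_Icc.1 i.2
      have hc : Continuous fun x : stripSet V k m => f i x :=
        (f i).continuous_of_finiteDimensional.comp continuous_subtype_val
      exact hc.continuousOn.congr fun x hx => hs i hi.1 hi.2 x hx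
  · intro i hi
    obtain ⟨h1, h2⟩ := Finset.mem_Icc.1 hi
    exact ⟨f i, hs i h1 h2⟩
  · intro x j hkj hjm hxj
    obtain ⟨h1, h2, -⟩ := hidx x
    have hkm : k ≤ m := h1.trans h2
    by_cases h : j ≤ m
    · have hx : (x : E) ∈ tri V j := hxj ▸ vertex_mem_tri le_rfl (by omega)
      change f (idx x) x = v j
      rw [hs j hkj h x hx, hxj]
      exact (hf j (by omega) (by omega)).1
    · have hx : (x : E) ∈ tri V m := hxj ▸ vertex_mem_tri (by omega) hjm
      change f (idx x) x = v j
      rw [hs m hkm le_rfl x hx, hxj]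
      obtain ⟨-, c2, c3⟩ := hf m (by omega) hm
      obtain rfl | rfl : j = m + 1 ∨ j = m + 2 := by omega
      · exact c2
      · exact c3

lemma finrank_stripSpace {n : ℕ} {V : ℕ → E} (hV : IsStrip n V) {k m : ℕ}
    (hk : 1 ≤ k) (hkm : k ≤ m) (hm : m ≤ n) :
    Module.finrank ℝ (stripSpace V k m) = m + 3 - k := by
  let p : Fin (m + 3 - k) → stripSet V k m := fun i =>
    ⟨V (k + i), vertex_mem_stripSet hkm (by omega) (by omega)⟩
  let L : stripSpace V k m →ₗ[ℝ] (Fin (m + 3 - k) → ℝ) :=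
    LinearMap.funLeft ℝ ℝ p ∘ₗ (stripSpace V k m).subtype
  have hL : Function.Bijective L := by
    constructor
    · intro s t hst
      refine Subtype.ext (stripSpace_ext s.2 t.2 fun x j hkj hjm hx => ?_)
      have := congrFun hst ⟨j - k, by omega⟩
      have hp : p ⟨j - k, by omega⟩ = x := by
        apply Subtype.ext
        change V (k + (j - k)) = x
        rw [hx, Nat.add_sub_cancel' hkj]
      change (s : stripSet V k m → ℝ) (p _) = (t : stripSet V k m → ℝ) (p _) at this
      rwa [hp] at this
    · intro v
      obtain ⟨s, hs, hsv⟩ := exists_mem_stripSpace_of_vertex_values hV hk hm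
        (fun j => if h : j - k < m + 3 - k then v ⟨j - k, h⟩ else 0)
      refine ⟨⟨s, hs⟩, funext fun i => ?_⟩
      have := hsv (p i) (k + i) (by omega) (by omega) rfl
      change s (p i) = v i
      rw [this]
      simp
  simpa using (LinearEquiv.ofBijective L hL).finrank_eq

lemma Poised.card_eq_finrank {V : ℕ → E} {k m : ℕ} {A : Finset E} (hA : ↑A ⊆ stripSet V k m)
    (h : Poised V k m A) : A.card = Module.finrank ℝ (stripSpace V k m) := by
  let p : A → stripSet V k m := fun a => ⟨a, hA a.2⟩
  let L : stripSpace V k m →ₗ[ℝ] (A → ℝ) :=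
    LinearMap.funLeft ℝ ℝ p ∘ₗ (stripSpace V k m).subtype
  have hL : Function.Bijective L := by
    constructor
    · intro s t hst
      let c : E → ℝ := fun x => if h : x ∈ stripSet V k m then s.1 ⟨x, h⟩ else 0
      refine Subtype.ext ((h c).unique ⟨s.2, fun a _ => ?_⟩ ⟨t.2, fun a ha => ?_⟩)
      · simp [c]
      · have := congrFun hst ⟨a, ha⟩
        change s.1 ⟨a, hA ha⟩ = t.1 ⟨a, hA ha⟩ at this
        simpa [c] using this.symm
    · intro v
      obtain ⟨s, ⟨hs, hsv⟩, -⟩ := h (fun x => if h : x ∈ A then v ⟨x, h⟩ else 0)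
      refine ⟨⟨s, hs⟩, funext fun a => ?_⟩
      have := hsv (p a) a.2
      change s (p a) = v a
      rw [this]
      simp [p]
  simpa using (LinearEquiv.ofBijective L hL).finrank_eq.symm

/-- The restriction of a function on a strip to a substrip. -/
def stripRestrict {V : ℕ → E} {k m k' m' : ℕ} (hk : k' ≤ k) (hm : m ≤ m')
    (s : stripSet V k' m' → ℝ) : stripSet V k m → ℝ :=
  fun x => s ⟨x, stripSet_mono hk hm x.2⟩

lemma stripRestrict_mem {V : ℕ → E} {k m k' m' : ℕ} (hk : k' ≤ k) (hm : m ≤ m')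
    {s : stripSet V k' m' → ℝ} (hs : s ∈ stripSpace V k' m') :
    stripRestrict hk hm s ∈ stripSpace V k m := by
  refine ⟨hs.1.comp (continuous_subtype_val.subtype_mk _), fun i hi => ?_⟩
  obtain ⟨h1, h2⟩ := Finset.mem_Icc.1 hi
  obtain ⟨f, hf⟩ := hs.2 i (Finset.mem_Icc.2 ⟨hk.trans h1, h2.trans hm⟩)
  exact ⟨f, fun x hx => hf ⟨x, _⟩ hx⟩

/-- Splines on two substrips separated by two triangles have a common extension. -/
lemma exists_stripRestrict_eq {n k : ℕ} {V : ℕ → E} (hV : IsStrip n V)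
    (hk : 1 ≤ k) {s₁ : stripSet V 1 (k - 1) → ℝ} {s₂ : stripSet V (k + 2) n → ℝ} (hs₁ : s₁ ∈ stripSpace V 1 (k - 1))
    (hs₂ : s₂ ∈ stripSpace V (k + 2) n) (hk₁ : k - 1 ≤ n) (hk₂ : 1 ≤ k + 2) :
    ∃ s ∈ stripSpace V 1 n, stripRestrict le_rfl hk₁ s = s₁ ∧
      stripRestrict hk₂ le_rfl s = s₂ := by
  let v : ℕ → ℝ := fun j =>
    if j ≤ k - 1 + 2 then (if h : V j ∈ stripSet V 1 (k - 1) then s₁ ⟨V j, h⟩ else 0)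
    else (if h : V j ∈ stripSet V (k + 2) n then s₂ ⟨V j, h⟩ else 0)
  obtain ⟨s, hs, hsv⟩ := exists_mem_stripSpace_of_vertex_values hV le_rfl le_rfl v
  refine ⟨s, hs, stripSpace_ext (stripRestrict_mem _ _ hs) hs₁ ?_,
    stripSpace_ext (stripRestrict_mem _ _ hs) hs₂ ?_⟩
  · rintro ⟨x, hx⟩ j h1 h2 rfl
    refine (hsv _ j h1 (by omega) rfl).trans ?_
    simp only [v]
    rw [if_pos h2, dif_pos hx]
  · rintro ⟨x, hx⟩ j h1 h2 rfl
    refine (hsv _ j (by omega) h2 rfl).trans ?_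
    simp only [v]
    rw [if_neg (by omega), dif_pos hx]

lemma stripRestrict_injective {n k : ℕ} {V : ℕ → E} (hk : 2 ≤ k) (hkn : k + 2 ≤ n)
    {s t : stripSet V 1 n → ℝ} (hs : s ∈ stripSpace V 1 n) (ht : t ∈ stripSpace V 1 n)
    (hk₁ : k - 1 ≤ n) (hk₂ : 1 ≤ k + 2)
    (h₁ : stripRestrict (V := V) (k := 1) le_rfl hk₁ s = stripRestrict le_rfl hk₁ t)
    (h₂ : stripRestrict (V := V) (m := n) hk₂ le_rfl s = stripRestrict hk₂ le_rfl t) :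
    s = t := by
  refine stripSpace_ext hs ht ?_
  rintro ⟨x, hx⟩ j h1 h2 rfl
  by_cases h : j ≤ k - 1 + 2
  · exact congrFun h₁ ⟨V j, vertex_mem_stripSet (by omega) h1 h⟩
  · exact congrFun h₂ ⟨V j, vertex_mem_stripSet hkn (by omega) h2⟩

/-- reduction "0+0": if in an exact problem `{△̄, A}` two
successive triangles `Δₖ`, `Δ_{k+1}` with `2 ≤ k ≤ n - 2` contain no nodes,
then `{△̄, A}` is poised iff both reduced problems `{△̄, A}₁^{k-1}` and
`{△̄, A}_{k+2}^n` are exact and poised. -/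
theorem reduction_00 (n k : ℕ) (V : ℕ → E) (hV : IsStrip n V)
    (A : Finset E) (hA : ↑A ⊆ stripSet V 1 n) (hexact : A.card = n + 2)
    (hk : 2 ≤ k) (hkn : k + 2 ≤ n)
    (hempty : ∀ a ∈ A, a ∉ tri V k ∧ a ∉ tri V (k + 1)) :
    Poised V 1 n A ↔
      ((nodesIn V 1 (k - 1) A).card = k + 1 ∧
       Poised V 1 (k - 1) (nodesIn V 1 (k - 1) A) ∧
       (nodesIn V (k + 2) n A).card = n - k + 1 ∧
       Poised V (k + 2) n (nodesIn V (k + 2) n A)) := by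
  have hk₁ : k - 1 ≤ n := by omega
  have hk₂ : 1 ≤ k + 2 := by omega
  have hcover : ∀ a ∈ A, a ∈ stripSet V 1 (k - 1) ∨ a ∈ stripSet V (k + 2) n := by
    intro a ha
    obtain ⟨i, h1, h2, h3⟩ := mem_stripSet.1 (hA ha)
    have hik : i ≠ k := by rintro rfl; exact (hempty a ha).1 h3
    have hik' : i ≠ k + 1 := by rintro rfl; exact (hempty a ha).2 h3
    by_cases h : i < k
    · exact Or.inl (tri_subset_stripSet h1 (by omega) h3)
    · exact Or.inr (tri_subset_stripSet (by omega) h2 h3)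
  constructor
  · intro hP
    have hP₁ : Poised V 1 (k - 1) (nodesIn V 1 (k - 1) A) := by
      intro c
      obtain ⟨s, ⟨hs, hsc⟩, -⟩ := hP c
      refine existsUnique_of_exists_of_unique
        ⟨stripRestrict le_rfl hk₁ s, stripRestrict_mem _ _ hs, fun a ha =>
          hsc ⟨a, _⟩ (Finset.mem_filter.1 ha).1⟩ ?_
      have key : ∀ t ∈ stripSpace V 1 (k - 1),
          (∀ a : stripSet V 1 (k - 1), (a : E) ∈ nodesIn V 1 (k - 1) A → t a = c a) →
          t = stripRestrict le_rfl hk₁ s := by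
        intro t ht htc
        obtain ⟨u, hu, hu₁, hu₂⟩ := exists_stripRestrict_eq hV (by omega) ht
          (stripRestrict_mem hk₂ le_rfl hs) hk₁ hk₂
        have hus : u = s := by
          refine (hP c).unique ⟨hu, fun a ha => ?_⟩ ⟨hs, hsc⟩
          rcases hcover a ha with h | h
          · exact (congrFun hu₁ ⟨a, h⟩).trans (htc ⟨a, h⟩ (Finset.mem_filter.2 ⟨ha, h⟩))
          · exact (congrFun hu₂ ⟨a, h⟩).trans (hsc _ ha)
        rw [← hu₁, hus]
      rintro t t' ⟨ht, htc⟩ ⟨ht', htc'⟩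
      rw [key t ht htc, key t' ht' htc']
    have hP₂ : Poised V (k + 2) n (nodesIn V (k + 2) n A) := by
      intro c
      obtain ⟨s, ⟨hs, hsc⟩, -⟩ := hP c
      refine existsUnique_of_exists_of_unique
        ⟨stripRestrict hk₂ le_rfl s, stripRestrict_mem _ _ hs, fun a ha =>
          hsc ⟨a, _⟩ (Finset.mem_filter.1 ha).1⟩ ?_
      have key : ∀ t ∈ stripSpace V (k + 2) n,
          (∀ a : stripSet V (k + 2) n, (a : E) ∈ nodesIn V (k + 2) n A → t a = c a) →
          t = stripRestrict hk₂ le_rfl s := by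
        intro t ht htc
        obtain ⟨u, hu, hu₁, hu₂⟩ := exists_stripRestrict_eq hV (by omega)
          (stripRestrict_mem le_rfl hk₁ hs) ht hk₁ hk₂
        have hus : u = s := by
          refine (hP c).unique ⟨hu, fun a ha => ?_⟩ ⟨hs, hsc⟩
          rcases hcover a ha with h | h
          · exact (congrFun hu₁ ⟨a, h⟩).trans (hsc _ ha)
          · exact (congrFun hu₂ ⟨a, h⟩).trans (htc ⟨a, h⟩ (Finset.mem_filter.2 ⟨ha, h⟩))
        rw [← hu₂, hus]
      rintro t t' ⟨ht, htc⟩ ⟨ht', htc'⟩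
      rw [key t ht htc, key t' ht' htc']
    refine ⟨?_, hP₁, ?_, hP₂⟩
    · rw [hP₁.card_eq_finrank (nodesIn_subset V _ _ A),
        finrank_stripSpace hV le_rfl (by omega) hk₁]
      omega
    · rw [hP₂.card_eq_finrank (nodesIn_subset V _ _ A),
        finrank_stripSpace hV hk₂ hkn le_rfl]
      omega
  · rintro ⟨-, hP₁, -, hP₂⟩ c
    obtain ⟨s₁, ⟨hs₁, hc₁⟩, -⟩ := hP₁ c
    obtain ⟨s₂, ⟨hs₂, hc₂⟩, -⟩ := hP₂ c
    obtain ⟨s, hs, hr₁, hr₂⟩ := exists_stripRestrict_eq hV (by omega) hs₁ hs₂ hk₁ hk₂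
    refine ⟨s, ⟨hs, fun a ha => ?_⟩, ?_⟩
    · rcases hcover a ha with h | h
      · exact (congrFun hr₁ ⟨a, h⟩).trans (hc₁ ⟨a, h⟩ (Finset.mem_filter.2 ⟨ha, h⟩))
      · exact (congrFun hr₂ ⟨a, h⟩).trans (hc₂ ⟨a, h⟩ (Finset.mem_filter.2 ⟨ha, h⟩))
    · rintro t ⟨ht, htc⟩
      refine stripRestrict_injective hk hkn ht hs hk₁ hk₂ ?_ ?_
      · rw [hr₁]
        exact (hP₁ c).unique ⟨stripRestrict_mem _ _ ht, fun a ha =>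
          htc ⟨a, _⟩ (Finset.mem_filter.1 ha).1⟩ ⟨hs₁, hc₁⟩
      · rw [hr₂]
        exact (hP₂ c).unique ⟨stripRestrict_mem _ _ ht, fun a ha =>
          htc ⟨a, _⟩ (Finset.mem_filter.1 ha).1⟩ ⟨hs₂, hc₂⟩
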